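/- arXiv:2304.02432 — 2 statements merged into one kernel-verified Lean document; each statement's English description precedes it below -/
import Mathlib

section
/- For all integers k ≥ 2, n ≥ 4, and 3 ≤ t ≤ n−1, the unique (up to isomorphism) k-partite k-uniform hypergraph with n vertices in each class, exactly t·n^{k−1} − 1 edges, and no matching of size t+1 is K^{(k)−}_{t,n}, obtained from K^{(k)}_{t,n} by deleting one edge. -/
open Finset in
theorem konig_aux (n t : ℕ) (htn : t + 1 ≤ n) (H : Fin n → Finset (Fin n))
    (hH : ¬ ∃ a b : Fin (t+1) → Fin n, Function.Injective a ∧ Function.Injective b ∧ ∀ s, b s ∈ H (a s)) :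
    ∃ A B : Finset (Fin n), A.card + B.card ≤ t ∧ ∀ j, j ∉ A → H j ⊆ B := by
  classical
  by_contra hcon
  push Not at hcon
  let d := n - (t+1)
  let H' : Fin n → Finset (Fin n ⊕ Fin d) := fun j => (H j).disjSum univ
  have hall : ∀ s : Finset (Fin n), s.card ≤ (s.biUnion H').card := by
    intro s
    rcases s.eq_empty_or_nonempty with rfl | ⟨j0, hj0⟩
    · simp
    have hsub : (s.biUnion H).disjSum (univ : Finset (Fin d)) ⊆ s.biUnion H' := by
      intro x hx
      rcases x with x | x
      · simp only [inl_mem_disjSum, mem_biUnion] at hx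
        obtain ⟨j, hj, hx⟩ := hx
        exact mem_biUnion.2 ⟨j, hj, by simp [H', hx]⟩
      · exact mem_biUnion.2 ⟨j0, hj0, by simp [H']⟩
    have h1 := card_le_card hsub
    rw [card_disjSum] at h1
    simp only [card_univ, Fintype.card_fin] at h1
    by_contra hlt
    have hc : sᶜ.card = n - s.card := by rw [card_compl, Fintype.card_fin]
    have hs : s.card ≤ n := by simpa using card_le_univ s
    obtain ⟨j, hj, hj2⟩ := hcon sᶜ (s.biUnion H) (by omega)
    apply hj2
    have : j ∈ s := by simpa using hj
    exact subset_biUnion_of_mem H this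
  obtain ⟨f, hf, hf2⟩ := (Finset.all_card_le_biUnion_card_iff_exists_injective H').1 hall
  let G : Finset (Fin n) := univ.filter (fun j => (f j).isLeft)
  have hG : (Gᶜ).card ≤ d := by
    have : (Gᶜ.image f) ⊆ (univ : Finset (Fin d)).image Sum.inr := by
      intro x hx
      simp only [mem_image] at hx ⊢
      obtain ⟨j, hj, rfl⟩ := hx
      simp only [G, mem_compl, mem_filter, mem_univ, true_and, Sum.not_isLeft, Sum.isRight_iff] at hj
      obtain ⟨y, hy⟩ := hj
      exact ⟨y, mem_univ _, hy.symm⟩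
    have h2 := card_le_card this
    rw [card_image_of_injective _ hf] at h2
    exact h2.trans (card_image_le.trans (by simp))
  have hGc : t + 1 ≤ G.card := by
    rw [card_compl, Fintype.card_fin] at hG
    omega
  obtain ⟨G', hG', hG'c⟩ := exists_subset_card_eq hGc
  let a : Fin (t+1) → Fin n := fun s => G'.orderEmbOfFin hG'c s
  have ha : ∀ s, (f (a s)).isLeft := by
    intro s
    have : a s ∈ G := hG' (orderEmbOfFin_mem _ _ _)
    simpa [G] using this
  choose b hb using fun s => Sum.isLeft_iff.1 (ha s)
  apply hH
  refine ⟨a, b, (G'.orderEmbOfFin hG'c).injective, ?_, ?_⟩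
  · intro s s' h
    have : f (a s) = f (a s') := by rw [hb, hb, h]
    exact (G'.orderEmbOfFin hG'c).injective (hf this)
  · intro s
    have := hf2 (a s)
    rw [hb] at this
    simpa [H'] using this

open Finset in
theorem bip_aux (n t : ℕ) (ht : 3 ≤ t) (htn : t + 1 ≤ n) (H : Fin n → Finset (Fin n))
    (hH : ¬ ∃ a b : Fin (t+1) → Fin n, Function.Injective a ∧ Function.Injective b ∧ ∀ s, b s ∈ H (a s)) :
    ∑ j, (H j).card ≤ t * n ∧ (t * n ≤ ∑ j, (H j).card + 1 →
      (∃ S : Finset (Fin n), S.card = t ∧ ∀ j, H j ⊆ S) ∨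
      (∃ T : Finset (Fin n), T.card = t ∧ ∀ j, j ∉ T → H j = ∅)) := by
  classical
  obtain ⟨A, B, hAB, hc⟩ := konig_aux n t htn H hH
  have hA : A.card ≤ n := by omega
  have key : ∑ j, (H j).card ≤ A.card * n + (n - A.card) * B.card := by
    rw [← sum_add_sum_compl A]
    apply add_le_add
    · calc _ ≤ ∑ j ∈ A, n := sum_le_sum (fun j _ => by simpa using card_le_univ (H j))
        _ = _ := by simp
    · calc _ ≤ ∑ j ∈ Aᶜ, B.card := sum_le_sum (fun j hj => card_le_card (hc j (by simpa using hj)))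
        _ = _ := by simp [card_compl]
  obtain ⟨r, hr⟩ := Nat.exists_eq_add_of_le hA
  have hr' : n - A.card = r := by omega
  rw [hr'] at key
  generalize ha : A.card = a at *
  generalize hb : B.card = b at *
  generalize ∑ j, (H j).card = s at *
  subst hr
  refine ⟨?_, ?_⟩
  · nlinarith [Nat.zero_le (a*b), mul_le_mul_right hAB (a+r)]
  · intro hs
    have h1 : a + b = t := by
      by_contra hne
      have : a + b + 1 ≤ t := by omega
      nlinarith [Nat.zero_le (a*b), Nat.mul_le_mul_right (a+r) this]
    subst h1
    have h2 : a * b ≤ 1 := by nlinarith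
    rcases Nat.eq_zero_or_pos a with h0 | h0
    · left
      have hA0 : A = ∅ := card_eq_zero.1 (ha.trans h0)
      exact ⟨B, by omega, fun j => hc j (by simp [hA0])⟩
    · rcases Nat.eq_zero_or_pos b with h0' | h0'
      · right
        have hB0 : B = ∅ := card_eq_zero.1 (hb.trans h0')
        refine ⟨A, by omega, fun j hj => ?_⟩
        simpa [hB0] using hc j hj
      · exfalso
        nlinarith

theorem ext_aux (n s : ℕ) (hs : s ≤ n) (a : Fin s → Fin n) (ha : Function.Injective a) :
    ∃ σ : Equiv.Perm (Fin n), ∀ j : Fin s, σ (Fin.castLE hs j) = a j := by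
  classical
  let e : {x : Fin n // x ∈ Set.range (Fin.castLE hs)} ≃ {x : Fin n // x ∈ Set.range a} :=
    (Equiv.ofInjective _ (Fin.castLE_injective hs)).symm.trans (Equiv.ofInjective a ha)
  refine ⟨e.extendSubtype, fun j => ?_⟩
  rw [Equiv.extendSubtype_apply_of_mem e _ ⟨j, rfl⟩]
  have : (Equiv.ofInjective _ (Fin.castLE_injective hs)).symm ⟨Fin.castLE hs j, ⟨j, rfl⟩⟩ = j := by
    rw [Equiv.symm_apply_eq]; rfl
  simp only [e, Equiv.trans_apply]
  erw [this]
  rfl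

open Finset in
theorem defect_aux (m n t : ℕ) (hm : 1 ≤ m) (hn : 1 ≤ n) (F : (Fin m → Fin n) → ℕ)
    (hF : t * n ^ m ≤ ∑ z, F z + 1)
    (hle : ∀ σ : Fin m → Equiv.Perm (Fin n), ∑ j, F (fun i => σ i j) ≤ t * n)
    (σ : Fin m → Equiv.Perm (Fin n)) : t * n ≤ ∑ j, F (fun i => σ i j) + 1 := by
  classical
  have : NeZero n := ⟨by omega⟩
  let g : (Fin m → Fin n) → ℕ := fun c => ∑ j, F (fun i => σ i (j + c i))
  have hg : ∀ c, g c ≤ t * n := fun c => by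
    have := hle (fun i => (Equiv.addRight (c i)).trans (σ i))
    simpa [g] using this
  have hsum : ∑ c, g c = n * ∑ z, F z := by
    simp only [g]
    rw [sum_comm]
    have : ∀ j : Fin n, ∑ c : Fin m → Fin n, F (fun i => σ i (j + c i)) = ∑ z, F z := by
      intro j
      exact Fintype.sum_equiv (Equiv.piCongrRight (fun i => (Equiv.addLeft j).trans (σ i))) _ _
        (fun c => by congr 1)
    simp [this]
  have hconst : ∀ a : Fin n, g (fun _ => a) = ∑ j, F (fun i => σ i j) := by
    intro a
    exact Fintype.sum_equiv (Equiv.addRight a) _ _ (fun c => by simp)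
  have hinj : Function.Injective (fun a : Fin n => (fun _ : Fin m => a)) := by
    intro a b h
    exact congrFun h ⟨0, hm⟩
  have h1 : ∑ c ∈ univ.image (fun a : Fin n => (fun _ : Fin m => a)), ((t*n : ℤ) - g c)
      ≤ ∑ c, ((t*n : ℤ) - g c) := by
    apply sum_le_sum_of_subset_of_nonneg (subset_univ _)
    intro c _ _
    have := hg c
    zify at this
    linarith
  rw [sum_image (fun a _ b _ h => hinj h)] at h1
  simp only [hconst] at h1
  have hR : ∑ c, ((t*n : ℤ) - g c) = n ^ m * (t * n) - n * ∑ z, (F z : ℤ) := by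
    rw [sum_sub_distrib, ← Nat.cast_sum, hsum]
    simp
  rw [hR] at h1
  simp at h1
  zify at hF ⊢
  have h2 : (n:ℤ) * (t * n) ≤ n * (∑ j, (F (fun i => σ i j) : ℤ) + 1) := by
    have hnn : (0:ℤ) ≤ n := by positivity
    nlinarith [mul_le_mul_of_nonneg_left hF hnn]
  exact le_of_mul_le_mul_left h2 (by positivity)

open Finset in
theorem step_aux (m n t : ℕ) (hm : 1 ≤ m) (hn : 4 ≤ n) (ht : 3 ≤ t) (htn : t + 1 ≤ n)
    (F : (Fin m → Fin n) → Finset (Fin n))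
    (hF : t * n ^ m ≤ ∑ z, (F z).card + 1)
    (hno : ¬ ∃ (z : Fin (t+1) → Fin m → Fin n) (b : Fin (t+1) → Fin n),
      (∀ i, Function.Injective (fun s => z s i)) ∧ Function.Injective b ∧ ∀ s, b s ∈ F (z s)) :
    (∃ S : Finset (Fin n), S.card = t ∧ ∀ z, F z ⊆ S) ∨
    (¬ ∃ z : Fin (t+1) → Fin m → Fin n,
      (∀ i, Function.Injective (fun s => z s i)) ∧ ∀ s, (F (z s)).Nonempty) := by
  classical
  have hnoσ : ∀ σ : Fin m → Equiv.Perm (Fin n),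
      ¬ ∃ a b : Fin (t+1) → Fin n, Function.Injective a ∧ Function.Injective b ∧
        ∀ s, b s ∈ F (fun i => σ i (a s)) := by
    rintro σ ⟨a, b, ha, hb, hab⟩
    exact hno ⟨fun s i => σ i (a s), b, fun i => (σ i).injective.comp ha, hb, hab⟩
  have hge := defect_aux m n t hm (by omega) (fun z => (F z).card) hF
    (fun σ => (bip_aux n t ht htn _ (hnoσ σ)).1)
  have hN := fun σ => (bip_aux n t ht htn _ (hnoσ σ)).2 (hge σ)
  -- two small fibres in one perfect matching force the row type
  have hrow : ∀ (σ : Fin m → Equiv.Perm (Fin n)) (j j' : Fin n), j ≠ j' →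
      (F (fun i => σ i j)).Nonempty → (F (fun i => σ i j)).card ≤ t →
      (F (fun i => σ i j')).Nonempty → (F (fun i => σ i j')).card ≤ t →
      ∃ S : Finset (Fin n), S.card = t ∧ ∀ j, F (fun i => σ i j) ⊆ S := by
    intro σ j j' hjj h1 h2 h3 h4
    rcases hN σ with h | ⟨T, hT, hT2⟩
    · exact h
    exfalso
    have hjT : j ∈ T := by
      by_contra h; exact h1.ne_empty (hT2 j h)
    have hjT' : j' ∈ T.erase j := by
      refine mem_erase.2 ⟨hjj.symm, ?_⟩
      by_contra h; exact h3.ne_empty (hT2 j' h)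
    have hs : ∑ x, (F (fun i => σ i x)).card = ∑ x ∈ T, (F (fun i => σ i x)).card := by
      symm
      apply sum_subset (subset_univ _)
      intro x _ hx
      rw [hT2 x hx, card_empty]
    have hb : ∑ x ∈ (T.erase j).erase j', (F (fun i => σ i x)).card
        ≤ ((T.erase j).erase j').card * n := by
      calc _ ≤ ∑ x ∈ (T.erase j).erase j', n :=
            sum_le_sum (fun x _ => by simpa using card_le_univ (F (fun i => σ i x)))
        _ = _ := by simp
    have hg := hge σ
    rw [hs, ← add_sum_erase T _ hjT, ← add_sum_erase _ _ hjT'] at hg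
    rw [card_erase_of_mem hjT', card_erase_of_mem hjT, hT] at hb
    obtain ⟨u, rfl⟩ := Nat.exists_eq_add_of_le ht
    have : 3 + u - 1 - 1 = u + 1 := by omega
    rw [this] at hb
    nlinarith
  have hrow2 : ∀ (σ : Fin m → Equiv.Perm (Fin n)) (S : Finset (Fin n)), S.card = t →
      (∀ j, F (fun i => σ i j) ⊆ S) → ∀ j, t ≤ (F (fun i => σ i j)).card + 1 := by
    intro σ S hS hS2 j
    have hg := hge σ
    rw [← add_sum_erase univ _ (mem_univ j)] at hg
    have hb : ∑ x ∈ univ.erase j, (F (fun i => σ i x)).card ≤ (n - 1) * t := by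
      calc _ ≤ ∑ x ∈ univ.erase j, t := sum_le_sum (fun x _ => by
              have := card_le_card (hS2 x); omega)
        _ = _ := by simp
    obtain ⟨u, rfl⟩ := Nat.exists_eq_add_of_le (show 1 ≤ n by omega)
    have : 1 + u - 1 = u := by omega
    rw [this] at hb
    nlinarith
  -- disjoint triples
  have htri : ∀ x y w : Fin m → Fin n, (∀ i, x i ≠ y i) → (∀ i, x i ≠ w i) → (∀ i, y i ≠ w i) →
      (F x).Nonempty → (F x).card ≤ t → (F y).Nonempty → (F y).card ≤ t →
      ∃ S : Finset (Fin n), S.card = t ∧ F x ⊆ S ∧ F y ⊆ S ∧ F w ⊆ S ∧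
        t ≤ (F w).card + 1 := by
    intro x y w hxy hxw hyw hx1 hx2 hy1 hy2
    have h3 : 3 ≤ n := by omega
    have : ∀ i, ∃ σ : Equiv.Perm (Fin n), ∀ j : Fin 3, σ (Fin.castLE h3 j) = ![x i, y i, w i] j := by
      intro i
      apply ext_aux
      intro a b hab
      have h1 := hxy i
      have h2 := hxw i
      have h3 := hyw i
      clear * - hab h1 h2 h3
      fin_cases a <;> fin_cases b <;> simp_all [eq_comm]
    choose σ hσ using this
    have e0 : (fun i => σ i (Fin.castLE h3 0)) = x := funext fun i => hσ i 0
    have e1 : (fun i => σ i (Fin.castLE h3 1)) = y := funext fun i => hσ i 1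
    have e2 : (fun i => σ i (Fin.castLE h3 2)) = w := funext fun i => hσ i 2
    obtain ⟨S, hS, hS2⟩ := hrow σ (Fin.castLE h3 0) (Fin.castLE h3 1)
      (by simp [Fin.ext_iff]) (by rwa [e0]) (by rwa [e0]) (by rwa [e1]) (by rwa [e1])
    refine ⟨S, hS, ?_, ?_, ?_, ?_⟩
    · have := hS2 (Fin.castLE h3 0); rwa [e0] at this
    · have := hS2 (Fin.castLE h3 1); rwa [e1] at this
    · have := hS2 (Fin.castLE h3 2); rwa [e2] at this
    · have := hrow2 σ S hS hS2 (Fin.castLE h3 2); rwa [e2] at this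
  have havoid : ∀ x y w : Fin m → Fin n, ∃ u : Fin m → Fin n,
      (∀ i, x i ≠ u i) ∧ (∀ i, y i ≠ u i) ∧ (∀ i, w i ≠ u i) := by
    intro x y w
    have : ∀ i, ∃ a : Fin n, x i ≠ a ∧ y i ≠ a ∧ w i ≠ a := by
      intro i
      have : ∃ a, a ∉ ({x i, y i, w i} : Finset (Fin n)) := by
        by_contra h
        push Not at h
        have h1 : (univ : Finset (Fin n)) ⊆ {x i, y i, w i} := fun a _ => h a
        have h2 := card_le_card h1
        have h3 := card_le_three (a := x i) (b := y i) (c := w i)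
        simp only [card_univ, Fintype.card_fin] at h2
        omega
      obtain ⟨a, ha⟩ := this
      simp only [mem_insert, mem_singleton, not_or] at ha
      exact ⟨a, Ne.symm ha.1, Ne.symm ha.2.1, Ne.symm ha.2.2⟩
    choose u hu using this
    exact ⟨u, fun i => (hu i).1, fun i => (hu i).2.1, fun i => (hu i).2.2⟩
  let R : (Fin m → Fin n) → Prop := fun z => t ≤ (F z).card + 1 ∧ (F z).card ≤ t
  have hRne : ∀ z, R z → (F z).Nonempty := by
    intro z hz
    apply card_pos.1
    have := hz.1
    omega
  have hprop : ∀ x y w : Fin m → Fin n, (∀ i, x i ≠ y i) → (∀ i, x i ≠ w i) → (∀ i, y i ≠ w i) →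
      R x → R y → R w := by
    intro x y w h1 h2 h3 hx hy
    obtain ⟨S, hS, -, -, h4, h5⟩ := htri x y w h1 h2 h3 (hRne x hx) hx.2 (hRne y hy) hy.2
    exact ⟨h5, hS ▸ card_le_card h4⟩
  by_cases hcase : ∃ x y : Fin m → Fin n, (∀ i, x i ≠ y i) ∧ R x ∧ R y
  · left
    obtain ⟨x, y, hxy, hx, hy⟩ := hcase
    have hall : ∀ w, R w := by
      intro w
      obtain ⟨u, hu1, hu2, hu3⟩ := havoid x y w
      have hu : R u := hprop x y u hxy hu1 hu2 hx hy
      obtain ⟨v, hv1, hv2, hv3⟩ := havoid x u w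
      have hv : R v := hprop x u v hu1 hv1 hv2 hx hu
      exact hprop u v w hv2 (fun i => (hu3 i).symm) (fun i => (hv3 i).symm) hu hv
    -- at most one deficient fibre
    obtain ⟨z0, hz0⟩ : ∃ z0, ∀ z, z ≠ z0 → (F z).card = t := by
      by_cases h : ∃ z0, (F z0).card ≠ t
      · obtain ⟨z0, h0⟩ := h
        refine ⟨z0, fun z hz => ?_⟩
        by_contra h1
        have a0 : (F z0).card + 1 ≤ t := by have := (hall z0).2; omega
        have a1 : (F z).card + 1 ≤ t := by have := (hall z).2; omega
        have hzm : z ∈ univ.erase z0 := by simp [hz]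
        rw [← add_sum_erase univ _ (mem_univ z0), ← add_sum_erase _ _ hzm] at hF
        have hb : ∑ z ∈ (univ.erase z0).erase z, (F z).card
            ≤ ((univ.erase z0).erase z).card * t := by
          calc _ ≤ ∑ z ∈ (univ.erase z0).erase z, t := sum_le_sum (fun z _ => (hall z).2)
            _ = _ := by simp
        have hcard : ((univ.erase z0).erase z).card + 2 = n ^ m := by
          have c1 := card_erase_add_one hzm
          have c2 := card_erase_add_one (mem_univ z0)
          have c3 : (univ : Finset (Fin m → Fin n)).card = n ^ m := by simp
          omega
        rw [← hcard] at hF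
        nlinarith
      · push Not at h
        exact ⟨x, fun z _ => h z⟩
    have hpair : ∀ z w : Fin m → Fin n, (∀ i, z i ≠ w i) →
        ∃ S : Finset (Fin n), S.card = t ∧ F z ⊆ S ∧ F w ⊆ S := by
      intro z w hzw
      obtain ⟨u, hu1, hu2, -⟩ := havoid z w w
      obtain ⟨S, hS, h1, h2, -, -⟩ := htri z w u hzw hu1 hu2 (hRne _ (hall z)) (hall z).2
        (hRne _ (hall w)) (hall w).2
      exact ⟨S, hS, h1, h2⟩
    have hsub : ∀ z w : Fin m → Fin n, (∀ i, z i ≠ w i) → w ≠ z0 → F z ⊆ F w := by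
      intro z w hzw hw
      obtain ⟨S, hS, h1, h2⟩ := hpair z w hzw
      have : F w = S := eq_of_subset_of_card_le h2 (by rw [hz0 w hw, hS])
      rwa [this]
    have hne : ∀ z w : Fin m → Fin n, (∀ i, z i ≠ w i) → w ≠ z := by
      rintro z w h rfl
      exact h ⟨0, hm⟩ rfl
    obtain ⟨z1, hz1, -, -⟩ := havoid z0 z0 z0
    refine ⟨F z1, hz0 z1 (hne _ _ hz1), fun z => ?_⟩
    obtain ⟨w, hw1, hw2, hw3⟩ := havoid z z1 z0
    exact (hsub z w hw1 (hne _ _ hw3)).trans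
      (hsub w z1 (fun i => (hw2 i).symm) (hne _ _ hz1))
  · right
    rintro ⟨z, hz, hzne⟩
    have : ∀ i, ∃ σ : Equiv.Perm (Fin n), ∀ j : Fin (t+1), σ (Fin.castLE htn j) = z j i :=
      fun i => ext_aux n (t+1) htn (fun s => z s i) (hz i)
    choose σ hσ using this
    have e : ∀ s, (fun i => σ i (Fin.castLE htn s)) = z s := fun s => funext fun i => hσ i s
    rcases hN σ with ⟨S, hS, hS2⟩ | ⟨T, hT, hT2⟩
    · apply hcase
      have hR : ∀ s, R (z s) := by
        intro s
        have h1 := hrow2 σ S hS hS2 (Fin.castLE htn s)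
        have h2 := card_le_card (hS2 (Fin.castLE htn s))
        rw [e] at h1 h2
        exact ⟨h1, hS ▸ h2⟩
      refine ⟨z ⟨0, by omega⟩, z ⟨1, by omega⟩, fun i h => ?_, hR _, hR _⟩
      have := hz i h
      simp at this
    · have h1 : (univ : Finset (Fin (t+1))).image (Fin.castLE htn) ⊆ T := by
        intro j hj
        obtain ⟨s, -, rfl⟩ := mem_image.1 hj
        by_contra h
        have := hT2 _ h
        rw [e] at this
        exact (hzne s).ne_empty this
      have h2 := card_le_card h1
      rw [card_image_of_injective _ (Fin.castLE_injective htn)] at h2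
      simp at h2
      omega

open Finset in
theorem main_aux (n t : ℕ) (hn : 4 ≤ n) (ht : 3 ≤ t) (htn : t + 1 ≤ n) (m : ℕ) :
    ∀ E : Finset (Fin (m+1) → Fin n), t * n ^ m ≤ E.card + 1 →
    (¬ ∃ e : Fin (t+1) → Fin (m+1) → Fin n, (∀ s, e s ∈ E) ∧
      ∀ i, Function.Injective (fun s => e s i)) →
    ∃ (i : Fin (m+1)) (S : Finset (Fin n)), S.card = t ∧ ∀ e ∈ E, e i ∈ S := by
  classical
  induction m with
  | zero =>
    intro E hE hno
    have hle : E.card ≤ t := by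
      by_contra h
      push Not at h
      obtain ⟨E', hE', hc⟩ := exists_subset_card_eq (show t + 1 ≤ E.card from h)
      let eq := (Finset.equivFinOfCardEq hc).symm
      apply hno
      refine ⟨fun s => (eq s).1, fun s => hE' (eq s).2, fun i a b hab => ?_⟩
      apply eq.injective
      apply Subtype.ext
      funext j
      have : j = i := by apply Fin.ext; omega
      subst this
      exact hab
    have h1 : (E.image (fun e => e 0)).card ≤ t := card_image_le.trans hle
    obtain ⟨S, hS, hS2⟩ := exists_superset_card_eq h1 (by simp; omega)
    exact ⟨0, S, hS2, fun e he => hS (mem_image_of_mem _ he)⟩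
  | succ m ih =>
    intro E hE hno
    let F : (Fin (m+1) → Fin n) → Finset (Fin n) := fun z =>
      univ.filter (fun x => (Fin.cons x z : Fin (m+2) → Fin n) ∈ E)
    have hsum : E.card = ∑ z, (F z).card := by
      rw [card_eq_sum_card_fiberwise (f := fun e => (Fin.tail e : Fin (m+1) → Fin n)) (t := univ)
        (by intro x _; simp)]
      refine sum_congr rfl (fun z _ => ?_)
      symm
      refine card_bij (fun x _ => (Fin.cons x z : Fin (m+2) → Fin n)) ?_ ?_ ?_
      · intro x hx
        simpa [F] using hx
      · intro x _ y _ h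
        exact congrFun h 0
      · intro e he
        simp only [mem_filter] at he
        refine ⟨e 0, ?_, ?_⟩
        · simp only [F, mem_filter, mem_univ, true_and]
          rw [← he.2, Fin.cons_self_tail]
          exact he.1
        · rw [← he.2, Fin.cons_self_tail]
    have hmemF : ∀ e ∈ E, e 0 ∈ F (Fin.tail e) := by
      intro e he
      simp only [F, mem_filter, mem_univ, true_and]
      rwa [Fin.cons_self_tail]
    have hnoF : ¬ ∃ (z : Fin (t+1) → Fin (m+1) → Fin n) (b : Fin (t+1) → Fin n),
        (∀ i, Function.Injective (fun s => z s i)) ∧ Function.Injective b ∧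
        ∀ s, b s ∈ F (z s) := by
      rintro ⟨z, b, hz, hb, hzb⟩
      apply hno
      refine ⟨fun s => Fin.cons (b s) (z s), fun s => by simpa [F] using hzb s, fun i => ?_⟩
      refine Fin.cases ?_ (fun i => ?_) i
      · simpa using hb
      · simpa using hz i
    rcases step_aux (m+1) n t (by omega) hn ht htn F (by rwa [← hsum]) hnoF with ⟨S, hS, hS2⟩ | h
    · exact ⟨0, S, hS, fun e he => hS2 _ (hmemF e he)⟩
    · let E' : Finset (Fin (m+1) → Fin n) := univ.filter (fun z => (F z).Nonempty)
      have hE' : t * n ^ m ≤ E'.card + 1 := by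
        have h1 : ∑ z, (F z).card ≤ E'.card * n := by
          calc ∑ z, (F z).card = ∑ z ∈ E', (F z).card := by
                symm
                apply sum_subset (subset_univ _)
                intro z _ hz
                simpa [E'] using hz
            _ ≤ ∑ z ∈ E', n := sum_le_sum (fun z _ => by simpa using card_le_univ (F z))
            _ = _ := by simp
        rw [hsum] at hE
        by_contra hlt
        push Not at hlt
        have h2 : (E'.card + 2) * n ≤ t * n ^ m * n := Nat.mul_le_mul_right n hlt
        rw [pow_succ] at hE
        nlinarith
      obtain ⟨i, S, hS, hS2⟩ := ih E' hE' (by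
        rintro ⟨e, he, hinj⟩
        exact h ⟨e, hinj, fun s => by simpa [E'] using he s⟩)
      refine ⟨i.succ, S, hS, fun e he => ?_⟩
      exact hS2 (Fin.tail e) (by
        simp only [E', mem_filter, mem_univ, true_and]
        exact ⟨_, hmemF e he⟩)

open Finset in
theorem card_aux (n m : ℕ) (i₀ : Fin (m+1)) (S : Finset (Fin n)) :
    ((univ : Finset (Fin (m+1) → Fin n)).filter (fun e => e i₀ ∈ S)).card = S.card * n ^ m := by
  classical
  have : (univ : Finset (Fin (m+1) → Fin n)).filter (fun e => e i₀ ∈ S)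
      = Fintype.piFinset (fun i => if i = i₀ then S else univ) := by
    ext e
    simp only [mem_filter, mem_univ, true_and, Fintype.mem_piFinset]
    constructor
    · intro h i
      by_cases hi : i = i₀
      · subst hi; simpa using h
      · simp [hi]
    · intro h
      simpa using h i₀
  rw [this, Fintype.card_piFinset, ← mul_prod_erase univ _ (mem_univ i₀)]
  have h2 : ∀ x ∈ univ.erase i₀, (if x = i₀ then S else (univ : Finset (Fin n))).card = n := by
    intro x hx
    rw [if_neg (ne_of_mem_erase hx)]; simp
  rw [prod_congr rfl h2]
  simp

/-- For `k ≥ 2`, `n ≥ 4`, `3 ≤ t ≤ n-1`: a `k`-partite `k`-graph with `n`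
vertices per class (edges as tuples) has exactly `t·n^(k-1) - 1` edges and no
matching of size `t+1` if and only if it is (a copy of) `K^{(k)-}_{t,n}`,
i.e. all tuples with `i₀`-coordinate in a fixed `t`-set `S`, minus one edge. -/
theorem stmt_3 (k n t : ℕ) (hk : 2 ≤ k) (hn : 4 ≤ n) (ht : 3 ≤ t) (htn : t ≤ n - 1)
    (E : Finset (Fin k → Fin n)) :
    (E.card = t * n ^ (k - 1) - 1 ∧
      ¬ ∃ M : Finset (Fin k → Fin n), M ⊆ E ∧ M.card = t + 1 ∧
        (∀ e ∈ M, ∀ f ∈ M, e ≠ f → ∀ i, e i ≠ f i)) ↔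
    (∃ (i₀ : Fin k) (S : Finset (Fin n)) (e₀ : Fin k → Fin n),
      S.card = t ∧ e₀ i₀ ∈ S ∧
      E = (Finset.univ.filter (fun e => e i₀ ∈ S)).erase e₀) := by
  classical
  obtain ⟨m, rfl⟩ : ∃ m, k = m + 1 := ⟨k - 1, by omega⟩
  have hkm : m + 1 - 1 = m := by omega
  rw [hkm]
  have hpos : 0 < t * n ^ m := by positivity
  constructor
  · rintro ⟨hcard, hno⟩
    obtain ⟨i, S, hS, hS2⟩ := main_aux n t hn ht (by omega) m E (by omega) (by
      rintro ⟨e, he, hinj⟩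
      apply hno
      have hinje : Function.Injective e := fun a b hab => hinj 0 (congrFun hab 0)
      refine ⟨Finset.univ.image e, ?_, ?_, ?_⟩
      · intro x hx
        obtain ⟨s, -, rfl⟩ := Finset.mem_image.1 hx
        exact he s
      · rw [Finset.card_image_of_injective _ hinje]; simp
      · intro x hx y hy hxy i hi
        obtain ⟨s, -, rfl⟩ := Finset.mem_image.1 hx
        obtain ⟨s', -, rfl⟩ := Finset.mem_image.1 hy
        exact hxy (congrArg e (hinj i hi)))
    have hK := card_aux n m i S
    have hsub : E ⊆ Finset.univ.filter (fun e => e i ∈ S) := fun e he => by simpa using hS2 e he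
    rw [hS] at hK
    have hd := Finset.card_sdiff_add_card_eq_card hsub
    obtain ⟨e₀, he₀⟩ := Finset.card_eq_one.1
      (show ((Finset.univ.filter (fun e => e i ∈ S)) \ E).card = 1 by omega)
    have hmem : e₀ ∈ (Finset.univ.filter (fun e => e i ∈ S)) \ E := by simp [he₀]
    refine ⟨i, S, e₀, hS, by simpa using (Finset.mem_sdiff.1 hmem).1, ?_⟩
    rw [Finset.erase_eq, ← he₀, Finset.sdiff_sdiff_eq_self hsub]
  · rintro ⟨i, S, e₀, hS, he₀, rfl⟩
    constructor
    · rw [Finset.card_erase_of_mem (by simpa using he₀), card_aux, hS]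
    · rintro ⟨M, hM, hMc, hMd⟩
      have h1 : M.image (fun e => e i) ⊆ S := by
        intro x hx
        obtain ⟨e, he, rfl⟩ := Finset.mem_image.1 hx
        have := Finset.mem_of_mem_erase (hM he)
        simpa using this
      have h2 := Finset.card_le_card h1
      rw [Finset.card_image_of_injOn, hMc, hS] at h2
      · omega
      · intro a ha b hb hab
        by_contra hne
        exact hMd a ha b hb hne i hab
end

section
/- Let Q be a 3-partite 3-graph with parts of size 4 each, |E(Q)| ≥ 47, and no matching of size 4. Then Q has a vertex cover consisting of 3 vertices all lying in the same part; in particular Q is a subgraph of K^{(3)}_{3,4} (so |E(Q)| ≤ 48), and if |E(Q)| = 47 then Q ≅ K^{(3)−}_{3,4}. -/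
/-- Coordinate selector for a 3-partite edge. -/
def coord3 : Fin 3 → Fin 4 × Fin 4 × Fin 4 → Fin 4
  | 0 => fun e => e.1
  | 1 => fun e => e.2.1
  | 2 => fun e => e.2.2

/-- Abbreviation for the vertex triples. -/
abbrev T3 : Type := Fin 4 × Fin 4 × Fin 4

/-- Hall's theorem applied to one permutation. -/
lemma hall_step (B : Fin 4 → Fin 4 → Prop) [∀ i j, Decidable (B i j)]
    (h : ∀ σ : Equiv.Perm (Fin 4), ∃ j, B (σ j) j) :
    4 ≤ (Finset.univ.filter (fun p : Fin 4 × Fin 4 => B p.1 p.2)).card ∧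
    ((Finset.univ.filter (fun p : Fin 4 × Fin 4 => B p.1 p.2)).card ≤ 5 →
      (∃ i, ∀ j, B i j) ∨ (∃ j, ∀ i, B i j)) := by
  classical
  let t : Fin 4 → Finset (Fin 4) := fun j => Finset.univ.filter (fun i => ¬ B i j)
  have hno : ¬ ∃ f : Fin 4 → Fin 4, Function.Injective f ∧ ∀ x, f x ∈ t x := by
    rintro ⟨f, hf, hft⟩
    obtain ⟨j, hj⟩ := h (Equiv.ofBijective f (Finite.injective_iff_bijective.mp hf))
    have := hft j
    simp only [t, Finset.mem_filter] at this
    exact this.2 hj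
  rw [← Finset.all_card_le_biUnion_card_iff_exists_injective t] at hno
  push Not at hno
  obtain ⟨s, hs⟩ := hno
  set N := s.biUnion t with hN
  have hsub : (Nᶜ ×ˢ s) ⊆ Finset.univ.filter (fun p : Fin 4 × Fin 4 => B p.1 p.2) := by
    rintro ⟨i, j⟩ hp
    simp only [Finset.mem_product, Finset.mem_compl, hN, Finset.mem_biUnion, t,
      Finset.mem_filter, Finset.mem_univ, true_and, not_exists, not_and, not_not] at hp ⊢
    exact hp.1 j hp.2
  have hc := Finset.card_le_card hsub
  rw [Finset.card_product, Finset.card_compl, Fintype.card_fin] at hc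
  have hs4 : s.card ≤ 4 := by simpa using Finset.card_le_univ s
  have hmem : ∀ i ∉ N, ∀ j ∈ s, B i j := by
    intro i hi j hj
    have := hsub (show (i, j) ∈ Nᶜ ×ˢ s by simp [hi, hj])
    simpa using this
  generalize hcard : (Finset.univ.filter (fun p : Fin 4 × Fin 4 => B p.1 p.2)).card = c at *
  have key : 4 ≤ c ∧ (c ≤ 5 → s.card = 1 ∧ N.card = 0 ∨ s.card = 4) := by
    generalize N.card = n at *
    generalize s.card = a at *
    interval_cases a <;> interval_cases n <;> omega
  refine ⟨key.1, fun h5 => ?_⟩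
  rcases key.2 h5 with ⟨h1, h0⟩ | h4
  · right
    obtain ⟨j, hj⟩ := Finset.card_eq_one.mp h1
    refine ⟨j, fun i => hmem i ?_ j (by simp [hj])⟩
    rw [Finset.card_eq_zero.mp h0]; simp
  · left
    have hu : s = Finset.univ := Finset.eq_univ_of_card s (by simpa using h4)
    have : ∃ i, i ∉ N := by
      by_contra hcon
      push Not at hcon
      have : N = Finset.univ := Finset.eq_univ_of_forall hcon
      rw [this] at hs
      simp [h4] at hs
    obtain ⟨i, hi⟩ := this
    exact ⟨i, fun j => hmem i hi j (by simp [hu])⟩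

/-- Elements of `F` lying over the graph of `τ`. -/
def ovr (F : Finset T3) (τ : Equiv.Perm (Fin 4)) : Finset T3 :=
  F.filter (fun e => e.2.2 = τ e.2.1)

/-- `F` meets every perfect matching. -/
def Hits (F : Finset T3) : Prop :=
  ∀ σ τ : Equiv.Perm (Fin 4), ∃ j, (σ j, j, τ j) ∈ F

lemma over_card (F : Finset T3) (τ : Equiv.Perm (Fin 4)) :
    (ovr F τ).card =
      (Finset.univ.filter (fun p : Fin 4 × Fin 4 => (p.1, p.2, τ p.2) ∈ F)).card := by
  refine Finset.card_bij' (fun e _ => (e.1, e.2.1)) (fun p _ => (p.1, p.2, τ p.2)) ?_ ?_ ?_ ?_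
  · rintro ⟨a, b, c⟩ h
    simp only [ovr, Finset.mem_filter] at h
    obtain ⟨h1, rfl⟩ := h
    simpa using h1
  · rintro ⟨a, b⟩ h
    simpa [ovr] using h
  · rintro ⟨a, b, c⟩ h
    simp only [ovr, Finset.mem_filter] at h
    obtain ⟨h1, rfl⟩ := h
    rfl
  · rintro ⟨a, b⟩ h
    rfl

lemma over_ge {F : Finset T3} (h : Hits F) (τ : Equiv.Perm (Fin 4)) : 4 ≤ (ovr F τ).card := by
  rw [over_card]
  exact (hall_step (fun i j => (i, j, τ j) ∈ F) (fun σ => h σ τ)).1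

lemma over_le {F : Finset T3} (h : Hits F) (hF : F.card ≤ 17) (τ : Equiv.Perm (Fin 4)) :
    (ovr F τ).card ≤ 5 := by
  have hsum := Finset.card_eq_sum_card_fiberwise (s := F) (t := (Finset.univ : Finset (Fin 4)))
    (f := fun e => τ.symm e.2.2 - e.2.1) (fun _ _ => Finset.mem_coe.mpr (Finset.mem_univ _))
  have hfib : ∀ s : Fin 4, F.filter (fun e => τ.symm e.2.2 - e.2.1 = s)
      = ovr F ((Equiv.addLeft s).trans τ) := by
    intro s
    ext e
    unfold ovr
    rw [Finset.mem_filter, Finset.mem_filter, sub_eq_iff_eq_add, Equiv.symm_apply_eq]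
    rfl
  have h0 : ovr F ((Equiv.addLeft 0).trans τ) = ovr F τ := by
    ext e
    simp [ovr]
  rw [Fin.sum_univ_four] at hsum
  simp only [hfib] at hsum
  rw [h0] at hsum
  have h1 := over_ge h ((Equiv.addLeft 1).trans τ)
  have h2 := over_ge h ((Equiv.addLeft 2).trans τ)
  have h3 := over_ge h ((Equiv.addLeft 3).trans τ)
  omega

lemma over_type {F : Finset T3} (h : Hits F) (hF : F.card ≤ 17) (τ : Equiv.Perm (Fin 4)) :
    (∃ i, ∀ j, (i, j, τ j) ∈ F) ∨ (∃ j, ∀ i, (i, j, τ j) ∈ F) := by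
  have := over_le h hF τ
  rw [over_card] at this
  exact (hall_step (fun i j => (i, j, τ j) ∈ F) (fun σ => h σ τ)).2 this

lemma exists_perm : ∀ j₀ j k₀ k : Fin 4, j ≠ j₀ → k ≠ k₀ →
    ∃ τ : Equiv.Perm (Fin 4), τ j₀ = k ∧ τ j = k₀ := by
  decide +kernel

/-- A full column over `j₀` together with two more points over `τ` is too much. -/
lemma over_big {F : Finset T3} {τ : Equiv.Perm (Fin 4)} {j₀ : Fin 4}
    (hle : (ovr F τ).card ≤ 5) (hfull : ∀ i, (i, j₀, τ j₀) ∈ F)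
    {a b : Fin 4 × Fin 4} (hab : a ≠ b) (ha : a.2 ≠ j₀) (hb : b.2 ≠ j₀)
    (haF : (a.1, a.2, τ a.2) ∈ F) (hbF : (b.1, b.2, τ b.2) ∈ F) : False := by
  rw [over_card] at hle
  have hsub : insert a (insert b (Finset.univ.image (fun i : Fin 4 => (i, j₀)))) ⊆
      Finset.univ.filter (fun p : Fin 4 × Fin 4 => (p.1, p.2, τ p.2) ∈ F) := by
    intro p hp
    simp only [Finset.mem_insert, Finset.mem_image, Finset.mem_univ, true_and] at hp
    simp only [Finset.mem_filter, Finset.mem_univ, true_and]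
    rcases hp with rfl | rfl | ⟨i, rfl⟩
    · exact haF
    · exact hbF
    · exact hfull i
  have hc := Finset.card_le_card hsub
  rw [Finset.card_insert_of_notMem, Finset.card_insert_of_notMem,
    Finset.card_image_of_injective] at hc
  · simp at hc
    omega
  · intro x y hxy
    simpa using hxy
  · simp only [Finset.mem_image, Finset.mem_univ, true_and, not_exists]
    rintro i rfl
    exact hb rfl
  · simp only [Finset.mem_insert, Finset.mem_image, Finset.mem_univ, true_and, not_or, not_exists]
    refine ⟨hab, ?_⟩
    rintro i rfl
    exact ha rfl

lemma exists_two : ∀ j₀ j : Fin 4, ∃ a b : Fin 4,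
    a ≠ b ∧ a ≠ j₀ ∧ a ≠ j ∧ b ≠ j₀ ∧ b ≠ j := by
  decide

/-- A full line forces a full layer. -/
lemma caseA {F : Finset T3} (h : Hits F) (hF : F.card ≤ 17) (j₀ k₀ : Fin 4)
    (hfull : ∀ i, (i, j₀, k₀) ∈ F) :
    (∀ i k, (i, j₀, k) ∈ F) ∨ (∀ i j, (i, j, k₀) ∈ F) := by
  have claim : ∀ j k, j ≠ j₀ → k ≠ k₀ → (∀ i, (i, j₀, k) ∈ F) ∨ (∀ i, (i, j, k₀) ∈ F) := by
    intro j k hj hk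
    obtain ⟨τ, h1, h2⟩ := exists_perm j₀ j k₀ k hj hk
    set τ' : Equiv.Perm (Fin 4) := (Equiv.swap j₀ j).trans τ with hτ'
    have e0 : τ' j₀ = k₀ := by simp [hτ', h2]
    have eo : ∀ x, x ≠ j₀ → x ≠ j → τ' x = τ x := by
      intro x hx hx'
      simp [hτ', Equiv.swap_apply_of_ne_of_ne hx hx']
    have hle := over_le h hF τ'
    have hfull' : ∀ i, (i, j₀, τ' j₀) ∈ F := by rw [e0]; exact hfull
    rcases over_type h hF τ with ⟨i, hi⟩ | ⟨x, hx⟩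
    · exfalso
      obtain ⟨a, b, hab, ha, ha', hb, hb'⟩ := exists_two j₀ j
      refine over_big hle hfull' (a := (i, a)) (b := (i, b)) ?_ ha hb ?_ ?_
      · simpa using hab
      · simpa [eo a ha ha'] using hi a
      · simpa [eo b hb hb'] using hi b
    · by_cases hx0 : x = j₀
      · subst hx0
        left
        rwa [h1] at hx
      · by_cases hxj : x = j
        · subst hxj
          right
          rwa [h2] at hx
        · exfalso
          refine over_big hle hfull' (a := (0, x)) (b := (1, x)) ?_ hx0 hx0 ?_ ?_
          · simp
          · simpa [eo x hx0 hxj] using hx 0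
          · simpa [eo x hx0 hxj] using hx 1
  by_contra hcon
  push Not at hcon
  obtain ⟨⟨i, k, hik⟩, i', j, hij⟩ := hcon
  have hk : k ≠ k₀ := by
    rintro rfl
    exact hik (hfull i)
  have hj : j ≠ j₀ := by
    rintro rfl
    exact hij (hfull i')
  rcases claim j k hj hk with hc | hc
  · exact hik (hc i)
  · exact hij (hc i')

lemma avoid_card : ∀ a b c d : Fin 4,
    (Finset.univ.filter (fun τ : Equiv.Perm (Fin 4) =>
      τ 0 ≠ a ∧ τ 1 ≠ b ∧ τ 2 ≠ c ∧ τ 3 ≠ d)).card ≤ 9 := by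
  decide +kernel

lemma union_card : ∀ τ τ' : Equiv.Perm (Fin 4), τ ≠ τ' →
    6 ≤ (Finset.univ.filter (fun p : Fin 4 × Fin 4 => p.2 = τ p.1 ∨ p.2 = τ' p.1)).card := by
  decide +kernel

/-- Without full lines there are not enough permutations. -/
lemma caseB {F : Finset T3} (hF : F.card ≤ 17)
    (h1 : ∀ τ : Equiv.Perm (Fin 4), ∃ i, ∀ j, (i, j, τ j) ∈ F)
    (h2 : ∀ i j, ∃ k, (i, j, k) ∉ F) : False := by
  choose z hz using h2
  let N : Fin 4 → Finset (Equiv.Perm (Fin 4)) :=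
    fun i => Finset.univ.filter (fun τ => ∀ j, (i, j, τ j) ∈ F)
  have hN9 : ∀ i, (N i).card ≤ 9 := by
    intro i
    refine le_trans (Finset.card_le_card ?_) (avoid_card (z i 0) (z i 1) (z i 2) (z i 3))
    intro τ hτ
    simp only [N, Finset.mem_filter, Finset.mem_univ, true_and] at hτ ⊢
    have : ∀ j, τ j ≠ z i j := by
      intro j hj
      have := hτ j
      rw [hj] at this
      exact hz i j this
    exact ⟨this 0, this 1, this 2, this 3⟩
  have hN1 : ∀ i, 1 < (N i).card → 6 ≤ (F.filter (fun e => e.1 = i)).card := by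
    intro i hi
    obtain ⟨τ, hτ, τ', hτ', hne⟩ := Finset.one_lt_card.mp hi
    simp only [N, Finset.mem_filter, Finset.mem_univ, true_and] at hτ hτ'
    refine le_trans (union_card τ τ' hne) ?_
    refine Finset.card_le_card_of_injOn (fun p => (i, p.1, p.2)) ?_ ?_
    · rintro ⟨j, k⟩ hp
      simp only [Finset.coe_filter, Finset.mem_univ, true_and, Set.mem_ofPred_eq] at hp ⊢
      refine ⟨?_, by trivial⟩
      rcases hp with rfl | rfl
      · exact hτ j
      · exact hτ' j
    · rintro ⟨a, b⟩ _ ⟨c, d⟩ _ hp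
      simpa using hp
  have hcov : (Finset.univ : Finset (Equiv.Perm (Fin 4))) ⊆ Finset.univ.biUnion N := by
    intro τ _
    obtain ⟨i, hi⟩ := h1 τ
    simp only [Finset.mem_biUnion, Finset.mem_univ, true_and, N, Finset.mem_filter]
    exact ⟨i, hi⟩
  have hc := (Finset.card_le_card hcov).trans Finset.card_biUnion_le
  rw [Finset.card_univ, Fintype.card_perm, Fintype.card_fin, Fin.sum_univ_four] at hc
  have h24 : Nat.factorial 4 = 24 := rfl
  rw [h24] at hc
  have hsum := Finset.card_eq_sum_card_fiberwise (s := F) (t := (Finset.univ : Finset (Fin 4)))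
    (f := fun e => e.1) (fun _ _ => Finset.mem_coe.mpr (Finset.mem_univ _))
  rw [Fin.sum_univ_four] at hsum
  have a0 := hN9 0
  have a1 := hN9 1
  have a2 := hN9 2
  have a3 := hN9 3
  have b0 := hN1 0
  have b1 := hN1 1
  have b2 := hN1 2
  have b3 := hN1 3
  omega

/-- The main structural result: a full layer exists. -/
lemma full_layer {F : Finset T3} (h : Hits F) (hF : F.card ≤ 17) :
    (∃ a, ∀ b c, (a, b, c) ∈ F) ∨ (∃ b, ∀ a c, (a, b, c) ∈ F) ∨
      (∃ c, ∀ a b, (a, b, c) ∈ F) := by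
  by_cases hA : ∃ j k, ∀ i, (i, j, k) ∈ F
  · obtain ⟨j, k, hjk⟩ := hA
    rcases caseA h hF j k hjk with h' | h'
    · exact Or.inr (Or.inl ⟨j, h'⟩)
    · exact Or.inr (Or.inr ⟨k, h'⟩)
  by_cases hB : ∃ i j, ∀ k, (i, j, k) ∈ F
  · obtain ⟨i, j, hij⟩ := hB
    let F' : Finset T3 := F.image (fun e => (e.2.2, e.2.1, e.1))
    have hmem : ∀ a b c, (a, b, c) ∈ F' ↔ (c, b, a) ∈ F := by
      intro a b c
      simp only [F', Finset.mem_image, Prod.mk.injEq, Prod.exists]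
      constructor
      · rintro ⟨x, y, w, hx, rfl, rfl, rfl⟩
        exact hx
      · intro hx
        exact ⟨c, b, a, hx, rfl, rfl, rfl⟩
    have hF' : F'.card ≤ 17 := Finset.card_image_le.trans hF
    have hH : Hits F' := by
      intro σ τ
      obtain ⟨x, hx⟩ := h τ σ
      exact ⟨x, (hmem _ _ _).mpr hx⟩
    rcases caseA hH hF' j i (fun k => (hmem _ _ _).mpr (hij k)) with h' | h'
    · exact Or.inr (Or.inl ⟨j, fun a c => (hmem _ _ _).mp (h' c a)⟩)
    · exact Or.inl ⟨i, fun b c => (hmem _ _ _).mp (h' c b)⟩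
  exfalso
  push Not at hA hB
  refine caseB hF (fun τ => ?_) hB
  rcases over_type h hF τ with h' | ⟨j, hj⟩
  · exact h'
  · obtain ⟨i, hi⟩ := hA j (τ j)
    exact absurd (hj i) hi

lemma layer_card : ∀ (i : Fin 3) (v : Fin 4), (Finset.univ.filter
    (fun e => coord3 i e ∈ (Finset.univ.erase v : Finset (Fin 4)))).card = 48 := by
  decide +kernel

/-- Finishing step from a full layer of non-edges. -/
lemma finish (E : Finset T3) (hcard : 47 ≤ E.card) (i : Fin 3) (v : Fin 4)
    (hv : ∀ e ∈ E, coord3 i e ≠ v) :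
    ∃ (i : Fin 3) (S : Finset (Fin 4)), S.card = 3 ∧
      (∀ e ∈ E, coord3 i e ∈ S) ∧
      E.card ≤ 48 ∧
      (E.card = 47 → ∃ e₀ : Fin 4 × Fin 4 × Fin 4, coord3 i e₀ ∈ S ∧
        E = (Finset.univ.filter (fun e => coord3 i e ∈ S)).erase e₀) := by
  have hL := layer_card i v
  have hS : ∀ e ∈ E, coord3 i e ∈ (Finset.univ.erase v : Finset (Fin 4)) := by
    intro e he
    simpa using hv e he
  refine ⟨i, Finset.univ.erase v, by simp, hS, ?_⟩
  generalize (Finset.univ.erase v : Finset (Fin 4)) = S at *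
  have hsub : E ⊆ Finset.univ.filter (fun e => coord3 i e ∈ S) := by
    intro e he
    simpa using hS e he
  refine ⟨hL ▸ Finset.card_le_card hsub, fun h47 => ?_⟩
  have hd : ((Finset.univ.filter (fun e => coord3 i e ∈ S)) \ E).card = 1 := by
    rw [Finset.card_sdiff_of_subset hsub, hL, h47]
  obtain ⟨e₀, he₀⟩ := Finset.card_eq_one.mp hd
  have hm : e₀ ∈ (Finset.univ.filter (fun e => coord3 i e ∈ S)) \ E := by simp [he₀]
  refine ⟨e₀, by simpa using (Finset.mem_sdiff.mp hm).1, ?_⟩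
  rw [← Finset.sdiff_singleton_eq_erase, ← he₀, Finset.sdiff_sdiff_eq_self hsub]

/-- A 3-partite 3-graph with parts of size 4, at least 47 edges, and no
matching of size 4 has a vertex cover of 3 vertices in a single part; in
particular `e(Q) ≤ 48`, and if `e(Q) = 47` then `Q ≅ K^{(3)−}_{3,4}`. -/
theorem stmt_16 (E : Finset (Fin 4 × Fin 4 × Fin 4)) (hcard : 47 ≤ E.card)
    (hM : ¬ ∃ M : Finset (Fin 4 × Fin 4 × Fin 4), M ⊆ E ∧ M.card = 4 ∧
      (∀ e ∈ M, ∀ f ∈ M, e ≠ f →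
        e.1 ≠ f.1 ∧ e.2.1 ≠ f.2.1 ∧ e.2.2 ≠ f.2.2)) :
    ∃ (i : Fin 3) (S : Finset (Fin 4)), S.card = 3 ∧
      (∀ e ∈ E, coord3 i e ∈ S) ∧
      E.card ≤ 48 ∧
      (E.card = 47 → ∃ e₀ : Fin 4 × Fin 4 × Fin 4, coord3 i e₀ ∈ S ∧
        E = (Finset.univ.filter (fun e => coord3 i e ∈ S)).erase e₀) := by
  classical
  have hH : Hits Eᶜ := by
    intro σ τ
    by_contra hcon
    push Not at hcon
    apply hM
    refine ⟨Finset.univ.image (fun j => (σ j, j, τ j)), ?_, ?_, ?_⟩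
    · intro e he
      simp only [Finset.mem_image, Finset.mem_univ, true_and] at he
      obtain ⟨j, rfl⟩ := he
      simpa using hcon j
    · rw [Finset.card_image_of_injective]
      · simp
      · intro x y hxy
        simp only [Prod.mk.injEq] at hxy
        exact hxy.2.1
    · intro e he f hf hne
      simp only [Finset.mem_image, Finset.mem_univ, true_and] at he hf
      obtain ⟨x, rfl⟩ := he
      obtain ⟨y, rfl⟩ := hf
      have hxy : x ≠ y := by
        rintro rfl
        exact hne rfl
      exact ⟨fun hh => hxy (σ.injective hh), hxy, fun hh => hxy (τ.injective hh)⟩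
  have hF : (Eᶜ).card ≤ 17 := by
    rw [Finset.card_compl]
    simp only [Fintype.card_prod, Fintype.card_fin]
    omega
  rcases full_layer hH hF with ⟨v, hv⟩ | ⟨v, hv⟩ | ⟨v, hv⟩
  · refine finish E hcard 0 v ?_
    rintro ⟨a, b, c⟩ he rfl
    exact (Finset.mem_compl.mp (hv b c)) he
  · refine finish E hcard 1 v ?_
    rintro ⟨a, b, c⟩ he rfl
    exact (Finset.mem_compl.mp (hv a c)) he
  · refine finish E hcard 2 v ?_
    rintro ⟨a, b, c⟩ he rfl
    exact (Finset.mem_compl.mp (hv a b)) he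
end
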